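/- For every a ∈ ℝ, ν > 0, t ≥ 0, integer ℓ, every β > 0, and every u ∈ H³(𝕋;ℂ), setting Lu = (∂_x² − ℓ²)u + (1/ν) B^ℓ u, one has the inequality −2β Re[ ⟨∂_x(L u), C^ℓ u⟩ + ⟨∂_x u, C^ℓ(L u)⟩ ] ≤ (4ℓ² + 2)β ‖∂_x u‖ ‖C^ℓ u‖ + 4β ‖∂_x² u‖ ‖C^ℓ(∂_x u)‖ − (2β/ν) ‖C^ℓ u‖². -/

import Mathlib

noncomputable def Bop (a ν t : ℝ) (ℓ : ℤ) (u : ℝ → ℂ) : ℝ → ℂ :=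
  fun x => (-Complex.I) * (a : ℂ) * (ℓ : ℂ) * (Real.exp (-(ν * t)) : ℂ) *
    (Real.sin x : ℂ) * u x

noncomputable def Cop (a ν t : ℝ) (ℓ : ℤ) (u : ℝ → ℂ) : ℝ → ℂ :=
  fun x => (-Complex.I) * (a : ℂ) * (ℓ : ℂ) * (Real.exp (-(ν * t)) : ℂ) *
    (Real.cos x : ℂ) * u x

/- The operator `L u = (∂ₓ² - ℓ²) u + (1/ν) B^ℓ u`. -/
noncomputable def Lop (a ν t : ℝ) (ℓ : ℤ) (u : ℝ → ℂ) : ℝ → ℂ :=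
  fun x => deriv (deriv u) x - (ℓ : ℂ) ^ 2 * u x + (1 / (ν : ℂ)) * Bop a ν t ℓ u x

/- L² inner product, norm and squared norm on the torus 𝕋 = ℝ/2πℤ. -/
noncomputable def tinner (f g : ℝ → ℂ) : ℂ :=
  ∫ x in (0:ℝ)..(2 * Real.pi), (starRingEnd ℂ) (f x) * g x

noncomputable def tnormSq (f : ℝ → ℂ) : ℝ :=
  ∫ x in (0:ℝ)..(2 * Real.pi), ‖f x‖ ^ 2

noncomputable def tnorm (f : ℝ → ℂ) : ℝ := Real.sqrt (tnormSq f)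

lemma aux_cs (f g : ℝ → ℂ) (hf : Continuous f) (hg : Continuous g) :
    |(tinner f g).re| ≤ tnorm f * tnorm g := by
  have hre : (tinner f g).re = ∫ x in (0:ℝ)..(2 * Real.pi), ((starRingEnd ℂ) (f x) * g x).re := by
    have hc : Continuous (fun x => (starRingEnd ℂ) (f x) * g x) :=
      (Complex.continuous_conj.comp hf).mul hg
    have := Complex.reCLM.intervalIntegral_comp_comm (μ := MeasureTheory.volume)
      (hc.intervalIntegrable 0 (2 * Real.pi))
    exact this.symm
  have hpi : (0:ℝ) ≤ 2 * Real.pi := by positivity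
  have hA : 0 ≤ tnormSq f := intervalIntegral.integral_nonneg hpi (fun x _ => by positivity)
  have hr : Continuous (fun x => ((starRingEnd ℂ) (f x) * g x).re) :=
    Complex.continuous_re.comp ((Complex.continuous_conj.comp hf).mul hg)
  have key : ∀ s : ℝ, 0 ≤ tnormSq g * (s * s) + (-2 * (tinner f g).re) * s + tnormSq f := by
    intro s
    have h1 : 0 ≤ ∫ x in (0:ℝ)..(2 * Real.pi), ‖f x - s * g x‖ ^ 2 :=
      intervalIntegral.integral_nonneg hpi (fun x _ => by positivity)
    have h2 : (∫ x in (0:ℝ)..(2 * Real.pi), ‖f x - s * g x‖ ^ 2)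
        = ∫ x in (0:ℝ)..(2 * Real.pi), ((s * s) * ‖g x‖ ^ 2
          + (-2 * s) * ((starRingEnd ℂ) (f x) * g x).re + ‖f x‖ ^ 2) := by
      congr 1
      ext x
      simp only [Complex.sq_norm, Complex.normSq_apply, Complex.sub_re, Complex.sub_im,
        Complex.mul_re, Complex.mul_im, Complex.ofReal_re, Complex.ofReal_im, Complex.conj_re,
        Complex.conj_im]
      ring
    rw [h2, intervalIntegral.integral_add, intervalIntegral.integral_add,
      intervalIntegral.integral_const_mul, intervalIntegral.integral_const_mul, ← hre] at h1
    · unfold tnormSq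
      linarith
    all_goals
      apply Continuous.intervalIntegrable
      fun_prop
  have hd := discrim_le_zero key
  unfold discrim at hd
  unfold tnorm
  rw [← Real.sqrt_mul hA]
  apply Real.abs_le_sqrt
  linarith

theorem stmt8 (a ν t : ℝ) (hν : 0 < ν) (ht : 0 ≤ t) (ℓ : ℤ) (β : ℝ) (hβ : 0 < β)
    (u : ℝ → ℂ) (hu : ContDiff ℝ 3 u) (hper : Function.Periodic u (2 * Real.pi)) :
    -2 * β * ((tinner (deriv (Lop a ν t ℓ u)) (Cop a ν t ℓ u)).re
        + (tinner (deriv u) (Cop a ν t ℓ (Lop a ν t ℓ u))).re) ≤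
      (4 * (ℓ : ℝ) ^ 2 + 2) * β * tnorm (deriv u) * tnorm (Cop a ν t ℓ u)
        + 4 * β * tnorm (deriv (deriv u)) * tnorm (Cop a ν t ℓ (deriv u))
        - (2 * β / ν) * tnormSq (Cop a ν t ℓ u) := by
  have hu1 : ContDiff ℝ 2 (deriv u) := ((contDiff_succ_iff_deriv (n := 2)).1 hu).2.2
  have hu2 : ContDiff ℝ 1 (deriv (deriv u)) := ((contDiff_succ_iff_deriv (n := 1)).1 hu1).2.2
  have c3 : Continuous (deriv (deriv (deriv u))) := hu2.continuous_deriv le_rfl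
  have d0 : ∀ x, HasDerivAt u (deriv u x) x := fun x =>
    ((hu.differentiable (by norm_num)) x).hasDerivAt
  have d1 : ∀ x, HasDerivAt (deriv u) (deriv (deriv u) x) x := fun x =>
    ((hu1.differentiable (by norm_num)) x).hasDerivAt
  have d2 : ∀ x, HasDerivAt (deriv (deriv u)) (deriv (deriv (deriv u)) x) x := fun x =>
    ((hu2.differentiable (by norm_num)) x).hasDerivAt
  have c0 := hu.continuous
  have c1 := hu1.continuous
  have c2 := hu2.continuous
  have p1 : Function.Periodic (deriv u) (2 * Real.pi) := by
    intro x
    rw [← deriv_comp_add_const]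
    congr 1
    ext y
    exact hper y
  have p2 : Function.Periodic (deriv (deriv u)) (2 * Real.pi) := by
    intro x
    rw [← deriv_comp_add_const]
    congr 1
    ext y
    exact p1 y
  generalize deriv (deriv (deriv u)) = u3 at *
  generalize hU2 : deriv (deriv u) = u2 at *
  generalize hU1 : deriv u = u1 at *
  obtain ⟨r, hr⟩ : ∃ r : ℝ, r = a * ℓ * Real.exp (-(ν * t)) := ⟨_, rfl⟩
  have hB : ∀ v : ℝ → ℂ, Bop a ν t ℓ v = fun x => -Complex.I * r * (Real.sin x : ℂ) * v x := by
    intro v; ext x; simp only [Bop, hr]; push_cast; ring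
  have hC : ∀ v : ℝ → ℂ, Cop a ν t ℓ v = fun x => -Complex.I * r * (Real.cos x : ℂ) * v x := by
    intro v; ext x; simp only [Cop, hr]; push_cast; ring
  have hL : Lop a ν t ℓ u = fun x => u2 x - (ℓ : ℂ) ^ 2 * u x
      + ((1 / ν : ℝ) : ℂ) * (-Complex.I * r * (Real.sin x : ℂ) * u x) := by
    ext x; simp only [Lop, hB, hU1, hU2]; push_cast; ring
  have ds : ∀ x : ℝ, HasDerivAt (fun y : ℝ => (Real.sin y : ℂ)) (Real.cos x : ℂ) x := fun x =>
    (Real.hasDerivAt_sin x).ofReal_comp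
  have dc : ∀ x : ℝ, HasDerivAt (fun y : ℝ => (Real.cos y : ℂ)) ((-Real.sin x : ℝ) : ℂ) x :=
    fun x => (Real.hasDerivAt_cos x).ofReal_comp
  have hdL : deriv (Lop a ν t ℓ u) = fun x => u3 x - (ℓ : ℂ) ^ 2 * u1 x
      + ((1 / ν : ℝ) : ℂ) * (-Complex.I * r * (Real.cos x : ℂ) * u x
        + -Complex.I * r * (Real.sin x : ℂ) * u1 x) := by
    ext x
    rw [hL]
    exact (((d2 x).sub ((d0 x).const_mul _)).add
      (((((ds x).const_mul (-Complex.I * (r:ℂ)))).mul (d0 x)).const_mul _)).deriv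
  have dconj : ∀ (v : ℝ → ℂ) (v' : ℂ) (x : ℝ), HasDerivAt v v' x →
      HasDerivAt (fun y => (starRingEnd ℂ) (v y)) ((starRingEnd ℂ) v') x := by
    intro v v' x h
    exact h.star
  -- the total derivative
  let G : ℝ → ℂ := fun x => (starRingEnd ℂ) (u2 x) * (-Complex.I * r * (Real.cos x : ℂ) * u x)
    + (starRingEnd ℂ) (u1 x) * (-Complex.I * r * (Real.sin x : ℂ) * u x)
  let G' : ℝ → ℂ := fun x =>
    ((starRingEnd ℂ) (u3 x) * (-Complex.I * r * (Real.cos x : ℂ) * u x)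
      + (starRingEnd ℂ) (u2 x) * (-Complex.I * r * ((-Real.sin x : ℝ) : ℂ) * u x
        + -Complex.I * r * (Real.cos x : ℂ) * u1 x))
    + ((starRingEnd ℂ) (u2 x) * (-Complex.I * r * (Real.sin x : ℂ) * u x)
      + (starRingEnd ℂ) (u1 x) * (-Complex.I * r * (Real.cos x : ℂ) * u x
        + -Complex.I * r * (Real.sin x : ℂ) * u1 x))
  have hG : ∀ x, HasDerivAt G (G' x) x := fun x =>
    ((dconj _ _ x (d2 x)).mul (((dc x).const_mul (-Complex.I * (r:ℂ))).mul (d0 x))).add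
    ((dconj _ _ x (d1 x)).mul (((ds x).const_mul (-Complex.I * (r:ℂ))).mul (d0 x)))
  have cc : Continuous (fun z : ℂ => (starRingEnd ℂ) z) := Complex.continuous_conj
  have ccv : ∀ v : ℝ → ℂ, Continuous v → Continuous (fun x => (starRingEnd ℂ) (v x)) :=
    fun v hv => cc.comp hv
  have k1 := ccv _ c1
  have k2 := ccv _ c2
  have k3 := ccv _ c3
  have cG' : Continuous G' := by fun_prop
  have iG : ∫ x in (0:ℝ)..(2 * Real.pi), G' x = 0 := by
    rw [intervalIntegral.integral_eq_sub_of_hasDerivAt (fun x _ => hG x)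
      (cG'.intervalIntegrable _ _)]
    have e0 := hper 0
    have e1 := p1 0
    have e2 := p2 0
    rw [zero_add] at e0 e1 e2
    simp only [G, e0, e1, e2, Real.sin_two_pi, Real.cos_two_pi, Real.sin_zero, Real.cos_zero]
    ring
  have cCu : Continuous (Cop a ν t ℓ u) := by rw [hC]; fun_prop
  have cCu1 : Continuous (Cop a ν t ℓ u1) := by rw [hC]; fun_prop
  have cL : Continuous (Lop a ν t ℓ u) := by rw [hL]; fun_prop
  have cCL : Continuous (Cop a ν t ℓ (Lop a ν t ℓ u)) := by rw [hC]; fun_prop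
  have cdL : Continuous (deriv (Lop a ν t ℓ u)) := by rw [hdL]; fun_prop
  have hre : ∀ h : ℝ → ℂ, Continuous h → (∫ x in (0:ℝ)..(2 * Real.pi), h x).re
      = ∫ x in (0:ℝ)..(2 * Real.pi), (h x).re := by
    intro h hc
    exact (Complex.reCLM.intervalIntegral_comp_comm (μ := MeasureTheory.volume)
      (hc.intervalIntegrable 0 (2 * Real.pi))).symm
  have tre : ∀ f g : ℝ → ℂ, Continuous f → Continuous g → (tinner f g).re
      = ∫ x in (0:ℝ)..(2 * Real.pi), ((starRingEnd ℂ) (f x) * g x).re := fun f g hf hg =>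
    hre _ ((ccv f hf).mul hg)
  have ii : ∀ f g : ℝ → ℂ, Continuous f → Continuous g → IntervalIntegrable
      (fun x => ((starRingEnd ℂ) (f x) * g x).re) MeasureTheory.volume 0 (2 * Real.pi) :=
    fun f g hf hg => (Complex.continuous_re.comp ((ccv f hf).mul hg)).intervalIntegrable _ _
  have iG're : IntervalIntegrable (fun x => (G' x).re) MeasureTheory.volume 0 (2 * Real.pi) :=
    (Complex.continuous_re.comp cG').intervalIntegrable _ _
  have iN : IntervalIntegrable (fun x => ‖Cop a ν t ℓ u x‖ ^ 2)
      MeasureTheory.volume 0 (2 * Real.pi) := by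
    apply Continuous.intervalIntegrable
    fun_prop
  have iG2 : ∫ x in (0:ℝ)..(2 * Real.pi), (G' x).re = 0 := by
    rw [← hre _ cG', iG]; rfl
  have main : (tinner (deriv (Lop a ν t ℓ u)) (Cop a ν t ℓ u)).re
        + (tinner u1 (Cop a ν t ℓ (Lop a ν t ℓ u))).re
      = -(2 * (ℓ:ℝ) ^ 2 + 1) * (tinner u1 (Cop a ν t ℓ u)).re
        + (-2) * (tinner u2 (Cop a ν t ℓ u1)).re
        + (1 / ν) * tnormSq (Cop a ν t ℓ u) := by
    have e : ∀ x, ((starRingEnd ℂ) (deriv (Lop a ν t ℓ u) x) * Cop a ν t ℓ u x).re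
        + ((starRingEnd ℂ) (u1 x) * Cop a ν t ℓ (Lop a ν t ℓ u) x).re
        = -(2 * (ℓ:ℝ) ^ 2 + 1) * ((starRingEnd ℂ) (u1 x) * Cop a ν t ℓ u x).re
        + (-2) * ((starRingEnd ℂ) (u2 x) * Cop a ν t ℓ u1 x).re
        + (1 / ν) * ‖Cop a ν t ℓ u x‖ ^ 2 + (G' x).re := by
      intro x
      have hl : (ℓ : ℂ) = (((ℓ : ℝ)) : ℂ) := by push_cast; rfl
      rw [hdL, hC, hC, hC, hL]
      simp only [G', hl, pow_two ((ℓ:ℝ) : ℂ)]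
      generalize (1 / ν) = m
      simp only [Complex.sq_norm, Complex.normSq_apply, Complex.sub_re, Complex.sub_im,
        Complex.add_re, Complex.add_im, Complex.neg_re, Complex.neg_im, Complex.I_re, Complex.I_im,
        Complex.mul_re, Complex.mul_im, Complex.ofReal_re, Complex.ofReal_im, Complex.conj_re,
        Complex.conj_im]
      ring
    rw [tre _ _ cdL cCu, tre _ _ c1 cCL, tre _ _ c1 cCu, tre _ _ c2 cCu1, tnormSq,
      ← intervalIntegral.integral_add (ii _ _ cdL cCu) (ii _ _ c1 cCL),
      intervalIntegral.integral_congr (fun x _ => e x),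
      intervalIntegral.integral_add
        ((((ii _ _ c1 cCu).const_mul _).add ((ii _ _ c2 cCu1).const_mul _)).add
          (iN.const_mul _)) iG're,
      intervalIntegral.integral_add
        (((ii _ _ c1 cCu).const_mul _).add ((ii _ _ c2 cCu1).const_mul _)) (iN.const_mul _),
      intervalIntegral.integral_add ((ii _ _ c1 cCu).const_mul _) ((ii _ _ c2 cCu1).const_mul _),
      intervalIntegral.integral_const_mul, intervalIntegral.integral_const_mul,
      intervalIntegral.integral_const_mul, iG2, add_zero]
  rw [main]
  have s1 := (abs_le.1 (aux_cs _ _ c1 cCu)).2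
  have s2 := (abs_le.1 (aux_cs _ _ c2 cCu1)).2
  have t1 := mul_le_mul_of_nonneg_left s1 (show 0 ≤ (4 * (ℓ:ℝ) ^ 2 + 2) * β by positivity)
  have t2 := mul_le_mul_of_nonneg_left s2 (show 0 ≤ 4 * β by positivity)
  have e3 : 2 * β / ν = 2 * β * (1 / ν) := by ring
  rw [e3]
  linarith
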